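/- arXiv:2509.10770 — 3 statements merged into one kernel-verified Lean document; each statement's English description precedes it below -/
import Mathlib

section
/- (Corollary 1 and strong duality.) Suppose (ĥ, ĉ) is a primal optimal solution of the HALS primal objective f. Then ẑ := b − ĥ − D ĉ is dual feasible, i.e., ‖ẑ‖*_A ≤ τ, and g(ẑ) = f(ĥ, ĉ). Consequently, ẑ maximizes the dual objective g over the dual feasible set {z ∈ ℂ^N : ‖z‖*_A ≤ τ}. -/
open scoped BigOperators
open MeasureTheory

noncomputable section

/-- The vector `a(f) ∈ ℂ^N` with entries `a(f)_k = exp(2πi k f)`. -/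
def aVec (N : ℕ) (f : ℝ) : Fin N → ℂ :=
  fun k => Complex.exp (((2 * Real.pi * (k : ℕ) * f : ℝ) : ℂ) * Complex.I)

/-- The atomic set `A = {exp(2πi φ) a(f) : f ∈ [0,1], φ ∈ [0,1]}`. -/
def atomSet (N : ℕ) : Set (Fin N → ℂ) :=
  { x | ∃ f φ : ℝ, f ∈ Set.Icc (0 : ℝ) 1 ∧ φ ∈ Set.Icc (0 : ℝ) 1 ∧
      x = fun k => Complex.exp (((2 * Real.pi * φ : ℝ) : ℂ) * Complex.I) * aVec N f k }

/-- Sums `Σ c_i` over finite decompositions `x = Σ c_i a_i`, `c_i > 0`, `a_i ∈ A`. -/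
def atomicDecomps (N : ℕ) (x : Fin N → ℂ) : Set ℝ :=
  { s | ∃ (p : ℕ) (c : Fin p → ℝ) (a : Fin p → (Fin N → ℂ)),
      (∀ i, 0 < c i) ∧ (∀ i, a i ∈ atomSet N) ∧
      (x = ∑ i, (c i : ℂ) • a i) ∧ s = ∑ i, c i }

/-- The atomic norm `‖x‖_A`. -/
def atomicNorm (N : ℕ) (x : Fin N → ℂ) : ℝ := sInf (atomicDecomps N x)

/-- The inner product `⟨u, v⟩ = Σ_k u_k conj(v_k)`. -/
def ip {N : ℕ} (u v : Fin N → ℂ) : ℂ := ∑ k, u k * (starRingEnd ℂ) (v k)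

/-- The dual atomic norm `‖z‖*_A = sup{Re⟨z,x⟩ : ‖x‖_A ≤ 1}`. -/
def dualAtomicNorm (N : ℕ) (z : Fin N → ℂ) : ℝ :=
  sSup { r : ℝ | ∃ x : Fin N → ℂ, atomicNorm N x ≤ 1 ∧ r = (ip z x).re }

/-- The Euclidean (ℓ²) norm of a complex vector. -/
def e2norm {ι : Type*} [Fintype ι] (u : ι → ℂ) : ℝ :=
  Real.sqrt (∑ k, Complex.normSq (u k))

/-- The HALS primal objective `f(h,c) = ½‖b − h − Dc‖₂² + τ‖h‖_A + (λ/2)‖c‖₂²`. -/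
def halsObj (N L : ℕ) (D : Matrix (Fin N) (Fin L) ℂ) (b : Fin N → ℂ) (τ lam : ℝ)
    (h : Fin N → ℂ) (c : Fin L → ℂ) : ℝ :=
  (1 / 2) * e2norm (b - h - D.mulVec c) ^ 2 + τ * atomicNorm N h
    + (lam / 2) * e2norm c ^ 2

/-- The HALS dual objective `g(z) = ½‖b‖₂² − ½‖b − z‖₂² − (1/(2λ))‖Dᴴz‖₂²`. -/
def halsDualObj (N L : ℕ) (D : Matrix (Fin N) (Fin L) ℂ) (b : Fin N → ℂ) (lam : ℝ)
    (z : Fin N → ℂ) : ℝ :=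
  (1 / 2) * e2norm b ^ 2 - (1 / 2) * e2norm (b - z) ^ 2
    - (1 / (2 * lam)) * e2norm (D.conjTranspose.mulVec z) ^ 2

lemma e2norm_sq {n : ℕ} (u : Fin n → ℂ) : e2norm u ^ 2 = (ip u u).re := by
  rw [e2norm, Real.sq_sqrt (Finset.sum_nonneg fun _ _ => Complex.normSq_nonneg _)]
  simp [ip, Complex.normSq_apply]

lemma ip_re_nonneg {n : ℕ} (u : Fin n → ℂ) : 0 ≤ (ip u u).re := by
  rw [← e2norm_sq]; positivity

lemma ip_add_left {n : ℕ} (u v w : Fin n → ℂ) : ip (u + v) w = ip u w + ip v w := by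
  simp [ip, add_mul, Finset.sum_add_distrib]

lemma ip_smul_left {n : ℕ} (r : ℂ) (u w : Fin n → ℂ) : ip (r • u) w = r * ip u w := by
  simp [ip, Finset.mul_sum, mul_assoc]

lemma ip_re_comm {n : ℕ} (u v : Fin n → ℂ) : (ip u v).re = (ip v u).re := by
  simp only [ip, Complex.re_sum]
  refine Finset.sum_congr rfl fun k _ => ?_
  simp; ring

lemma ip_re_add_left {n : ℕ} (u v w : Fin n → ℂ) :
    (ip (u + v) w).re = (ip u w).re + (ip v w).re := by
  rw [ip_add_left, Complex.add_re]

lemma ip_re_smul_left {n : ℕ} (t : ℝ) (u w : Fin n → ℂ) :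
    (ip ((t : ℂ) • u) w).re = t * (ip u w).re := by
  rw [ip_smul_left, Complex.re_ofReal_mul]

lemma ip_re_add_right {n : ℕ} (u v w : Fin n → ℂ) :
    (ip w (u + v)).re = (ip w u).re + (ip w v).re := by
  rw [ip_re_comm, ip_re_add_left, ip_re_comm u, ip_re_comm v]

lemma ip_re_smul_right {n : ℕ} (t : ℝ) (u w : Fin n → ℂ) :
    (ip w ((t : ℂ) • u)).re = t * (ip w u).re := by
  rw [ip_re_comm, ip_re_smul_left, ip_re_comm]

lemma ip_re_sum_smul_right {n : ℕ} {ι : Type*} (s : Finset ι) (c : ι → ℝ)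
    (a : ι → Fin n → ℂ) (z : Fin n → ℂ) :
    (ip z (∑ i ∈ s, (c i : ℂ) • a i)).re = ∑ i ∈ s, c i * (ip z (a i)).re := by
  classical
  induction s using Finset.induction_on with
  | empty => simp [ip]
  | insert i s hi ih =>
    rw [Finset.sum_insert hi, Finset.sum_insert hi, ip_re_add_right, ip_re_smul_right, ih]

lemma e2norm_sq_add_smul {n : ℕ} (u v : Fin n → ℂ) (t : ℝ) :
    e2norm (u + (t : ℂ) • v) ^ 2
      = e2norm u ^ 2 + 2 * t * (ip u v).re + t ^ 2 * e2norm v ^ 2 := by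
  simp only [e2norm_sq, ip_re_add_left, ip_re_add_right, ip_re_smul_left, ip_re_smul_right,
    ip_re_comm v u]
  ring

lemma ip_mulVec_left {n m : ℕ} (D : Matrix (Fin n) (Fin m) ℂ) (c : Fin m → ℂ) (z : Fin n → ℂ) :
    ip (D.mulVec c) z = ip c (D.conjTranspose.mulVec z) := by
  simp only [ip, Matrix.mulVec, dotProduct, Finset.sum_mul, map_sum, Finset.mul_sum]
  rw [Finset.sum_comm]
  refine Finset.sum_congr rfl fun i _ => Finset.sum_congr rfl fun j _ => ?_
  simp [Matrix.conjTranspose_apply]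
  ring

lemma eq_zero_of_ip_re_nonpos {n : ℕ} {u : Fin n → ℂ} (h : (ip u u).re ≤ 0) : u = 0 := by
  have h0 : ∑ k, Complex.normSq (u k) ≤ 0 := by
    simpa [ip, Complex.normSq_apply] using h
  have h1 := (Finset.sum_eq_zero_iff_of_nonneg fun k _ => Complex.normSq_nonneg (u k)).1
    (h0.antisymm (Finset.sum_nonneg fun k _ => Complex.normSq_nonneg (u k)))
  funext k
  exact Complex.normSq_eq_zero.1 (h1 k (Finset.mem_univ k))

lemma sum_mem_atomicDecomps {N : ℕ} {ι : Type*} [Fintype ι] (c : ι → ℝ) (a : ι → Fin N → ℂ)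
    (hc : ∀ i, 0 ≤ c i) (ha : ∀ i, a i ∈ atomSet N) :
    ∑ i, c i ∈ atomicDecomps N (∑ i, (c i : ℂ) • a i) := by
  classical
  let e := Fintype.equivFin {i // 0 < c i}
  have key : ∀ {M : Type} [AddCommMonoid M] (g : ι → M), (∀ i, c i = 0 → g i = 0) →
      ∑ i, g i = ∑ j, g (e.symm j).1 := by
    intro M _ g hg
    rw [e.symm.sum_comp fun i : {i // 0 < c i} => g i.1,
      ← Finset.sum_subtype (Finset.univ.filter (0 < c ·)) (by simp) g]
    symm
    refine Finset.sum_subset (Finset.subset_univ _) fun i _ hi => hg i ?_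
    exact le_antisymm (by simpa using hi) (hc i)
  exact ⟨_, fun j => c (e.symm j).1, fun j => a (e.symm j).1, fun j => (e.symm j).2,
    fun j => ha _, key _ (fun i hi => by simp [hi]), key _ fun i hi => hi⟩

lemma exists_phase (y : ℂ) : ∃ φ ∈ Set.Icc (0 : ℝ) 1,
    y = (‖y‖ : ℂ) * Complex.exp (((2 * Real.pi * φ : ℝ) : ℂ) * Complex.I) := by
  refine ⟨Int.fract (y.arg / (2 * Real.pi)), ⟨Int.fract_nonneg _, (Int.fract_lt_one _).le⟩, ?_⟩
  conv_lhs => rw [← Complex.norm_mul_exp_arg_mul_I y]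
  congr 1
  rw [Complex.exp_eq_exp_iff_exists_int]
  refine ⟨⌊y.arg / (2 * Real.pi)⌋, ?_⟩
  have hpi : (Real.pi : ℂ) ≠ 0 := by exact_mod_cast Real.pi_ne_zero
  rw [← Int.self_sub_floor]
  push_cast
  field_simp
  ring

lemma exists_sum_aVec {N : ℕ} (hN : 1 ≤ N) (x : Fin N → ℂ) :
    ∃ y : Fin N → ℂ, x = ∑ m : Fin N, y m • aVec N ((m : ℕ) / N) := by
  let v : Fin N → ℂ := fun m => Complex.exp (2 * Real.pi * Complex.I / N) ^ (m : ℕ)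
  have hv : Function.Injective v := fun i j h => Fin.ext <|
    (Complex.isPrimitiveRoot_exp N (by omega)).pow_inj i.2 j.2 h
  have hdet : IsUnit (Matrix.vandermonde v).det :=
    (Matrix.det_vandermonde_ne_zero_iff.2 hv).isUnit
  refine ⟨Matrix.vecMul x (Matrix.vandermonde v)⁻¹, ?_⟩
  have hx : Matrix.vecMul (Matrix.vecMul x (Matrix.vandermonde v)⁻¹) (Matrix.vandermonde v) = x := by
    rw [Matrix.vecMul_vecMul, Matrix.nonsing_inv_mul _ hdet, Matrix.vecMul_one]
  conv_lhs => rw [← hx]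
  funext k
  rw [Matrix.vecMul, dotProduct, Finset.sum_apply]
  refine Finset.sum_congr rfl fun m _ => ?_
  simp only [Matrix.vandermonde_apply, Pi.smul_apply, smul_eq_mul, aVec, v]
  rw [← Complex.exp_nat_mul, ← Complex.exp_nat_mul]
  congr 2
  push_cast
  ring

lemma atomicDecomps_nonempty {N : ℕ} (hN : 1 ≤ N) (x : Fin N → ℂ) :
    (atomicDecomps N x).Nonempty := by
  obtain ⟨y, hy⟩ := exists_sum_aVec hN x
  choose φ hφ hyφ using fun m => exists_phase (y m)
  have hN0 : (0 : ℝ) < N := by exact_mod_cast hN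
  have hmem := sum_mem_atomicDecomps (N := N) (fun m => ‖y m‖)
    (fun (m : Fin N) k => Complex.exp (((2 * Real.pi * φ m : ℝ) : ℂ) * Complex.I)
      * aVec N ((m : ℕ) / N) k)
    (fun m => norm_nonneg _)
    (fun m => ⟨(m : ℕ) / N, φ m, ⟨by positivity, by
      rw [div_le_one hN0]; exact_mod_cast m.2.le⟩, hφ m, rfl⟩)
  convert Set.nonempty_of_mem hmem using 2
  rw [hy]
  refine Finset.sum_congr rfl fun m _ => ?_
  funext k
  simp only [Pi.smul_apply, smul_eq_mul]
  rw [← mul_assoc, ← hyφ m]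

lemma nonneg_of_mem_atomicDecomps {N : ℕ} {x : Fin N → ℂ} {s : ℝ}
    (hs : s ∈ atomicDecomps N x) : 0 ≤ s := by
  obtain ⟨p, c, a, hc, -, -, rfl⟩ := hs
  exact Finset.sum_nonneg fun i _ => (hc i).le

lemma atomicNorm_le_of_mem {N : ℕ} {x : Fin N → ℂ} {s : ℝ} (hs : s ∈ atomicDecomps N x) :
    atomicNorm N x ≤ s :=
  csInf_le ⟨0, fun _ => nonneg_of_mem_atomicDecomps⟩ hs

lemma atomicNorm_le_one_of_mem_atomSet {N : ℕ} {a : Fin N → ℂ} (ha : a ∈ atomSet N) :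
    atomicNorm N a ≤ 1 := by
  have := sum_mem_atomicDecomps (ι := Unit) (fun _ => 1) (fun _ => a) (by simp) (fun _ => ha)
  exact atomicNorm_le_of_mem (by simpa using this)

lemma atomicNorm_add_le {N : ℕ} (hN : 1 ≤ N) (x y : Fin N → ℂ) :
    atomicNorm N (x + y) ≤ atomicNorm N x + atomicNorm N y := by
  have add_mem : ∀ s ∈ atomicDecomps N x, ∀ r ∈ atomicDecomps N y,
      s + r ∈ atomicDecomps N (x + y) := by
    rintro _ ⟨p, c, a, hc, ha, hx, rfl⟩ _ ⟨q, d, b, hd, hb, hy, rfl⟩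
    have h := sum_mem_atomicDecomps (Sum.elim c d) (Sum.elim a b)
      (by rintro (i | i) <;> simp [(hc _).le, (hd _).le])
      (by rintro (i | i) <;> simp [ha, hb])
    simp only [Fintype.sum_sum_type, Sum.elim_inl, Sum.elim_inr] at h
    rwa [← hx, ← hy] at h
  have h1 : ∀ s ∈ atomicDecomps N x, atomicNorm N (x + y) - s ≤ atomicNorm N y := fun s hs =>
    le_csInf (atomicDecomps_nonempty hN y) fun r hr => by
      linarith [atomicNorm_le_of_mem (add_mem s hs r hr)]
  have h2 : atomicNorm N (x + y) - atomicNorm N y ≤ atomicNorm N x :=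
    le_csInf (atomicDecomps_nonempty hN x) fun s hs => by linarith [h1 s hs]
  linarith

lemma atomicNorm_smul_le {N : ℕ} (hN : 1 ≤ N) {t : ℝ} (ht : 0 ≤ t) (x : Fin N → ℂ) :
    atomicNorm N ((t : ℂ) • x) ≤ t * atomicNorm N x := by
  have smul_mem : ∀ s ∈ atomicDecomps N x, t * s ∈ atomicDecomps N ((t : ℂ) • x) := by
    rintro _ ⟨p, c, a, hc, ha, rfl, rfl⟩
    have h := sum_mem_atomicDecomps (fun i => t * c i) a (fun i => mul_nonneg ht (hc i).le) ha
    simpa [Finset.mul_sum, Finset.smul_sum, mul_smul] using h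
  rcases ht.eq_or_lt with rfl | ht'
  · obtain ⟨s, hs⟩ := atomicDecomps_nonempty hN x
    simpa using atomicNorm_le_of_mem (smul_mem s hs)
  · rw [← div_le_iff₀' ht']
    exact le_csInf (atomicDecomps_nonempty hN x) fun s hs => by
      rw [div_le_iff₀' ht']
      exact atomicNorm_le_of_mem (smul_mem s hs)

lemma ip_re_le_mul_atomicNorm {N : ℕ} (hN : 1 ≤ N) {z : Fin N → ℂ} {M : ℝ} (hM : 0 ≤ M)
    (h : ∀ a ∈ atomSet N, (ip z a).re ≤ M) (x : Fin N → ℂ) :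
    (ip z x).re ≤ M * atomicNorm N x := by
  have hdec : ∀ s ∈ atomicDecomps N x, (ip z x).re ≤ M * s := by
    rintro _ ⟨p, c, a, hc, ha, rfl, rfl⟩
    rw [ip_re_sum_smul_right, Finset.mul_sum]
    refine Finset.sum_le_sum fun i _ => ?_
    rw [mul_comm]
    exact mul_le_mul_of_nonneg_right (h _ (ha i)) (hc i).le
  rcases hM.eq_or_lt with rfl | hM'
  · obtain ⟨s, hs⟩ := atomicDecomps_nonempty hN x
    simpa using hdec s hs
  · rw [← div_le_iff₀' hM']
    exact le_csInf (atomicDecomps_nonempty hN x) fun s hs => by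
      rw [div_le_iff₀' hM']
      exact hdec s hs

lemma ip_re_le_sum_norm_of_mem_atomSet {N : ℕ} (z : Fin N → ℂ) {a : Fin N → ℂ}
    (ha : a ∈ atomSet N) : (ip z a).re ≤ ∑ k, ‖z k‖ := by
  obtain ⟨f, φ, -, -, rfl⟩ := ha
  rw [ip, Complex.re_sum]
  refine Finset.sum_le_sum fun k _ => (Complex.re_le_norm _).trans ?_
  rw [norm_mul, RCLike.norm_conj, norm_mul, aVec, Complex.norm_exp_ofReal_mul_I,
    Complex.norm_exp_ofReal_mul_I]
  simp

lemma ip_re_le_of_dualAtomicNorm_le {N : ℕ} (hN : 1 ≤ N) {z : Fin N → ℂ} {τ : ℝ} (hτ : 0 ≤ τ)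
    (h : dualAtomicNorm N z ≤ τ) (x : Fin N → ℂ) : (ip z x).re ≤ τ * atomicNorm N x := by
  have hS : 0 ≤ ∑ k, ‖z k‖ := Finset.sum_nonneg fun k _ => norm_nonneg _
  refine ip_re_le_mul_atomicNorm hN hτ (fun a ha => le_trans ?_ h) x
  refine le_csSup ⟨∑ k, ‖z k‖, ?_⟩ ⟨a, atomicNorm_le_one_of_mem_atomSet ha, rfl⟩
  rintro _ ⟨y, hy, rfl⟩
  exact (ip_re_le_mul_atomicNorm hN hS (fun _ => ip_re_le_sum_norm_of_mem_atomSet z) y).trans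
    (mul_le_of_le_one_right hS hy)

lemma dualAtomicNorm_le_of_ip_re_le {N : ℕ} {z : Fin N → ℂ} {τ : ℝ} (hτ : 0 ≤ τ)
    (h : ∀ x, (ip z x).re ≤ τ * atomicNorm N x) : dualAtomicNorm N z ≤ τ := by
  refine Real.sSup_le ?_ hτ
  rintro _ ⟨x, hx, rfl⟩
  exact (h x).trans (mul_le_of_le_one_right hτ hx)

lemma nonneg_of_forall_small {A B : ℝ}
    (h : ∀ t : ℝ, 0 < t → t ≤ 1 → 0 ≤ t * A + t ^ 2 * B) : 0 ≤ A := by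
  by_contra! hA
  have hB : 0 < |B| - A := by linarith [abs_nonneg B]
  have ht : 0 < -A / (2 * (|B| - A)) := by apply div_pos <;> linarith
  have ht1 : -A / (2 * (|B| - A)) ≤ 1 := by
    rw [div_le_one (by linarith)]; linarith [abs_nonneg B]
  have h1 := h _ ht ht1
  set t := -A / (2 * (|B| - A)) with htdef
  have h2 : 0 ≤ A + t * B := by
    by_contra! hc
    nlinarith
  have h3 : t * (2 * (|B| - A)) = -A := by rw [htdef]; field_simp
  nlinarith [mul_le_mul_of_nonneg_left (le_abs_self B) ht.le]

/-- The duality gap is a sum of two squares and the gap in the dual-norm inequality at `h`. -/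
lemma halsObj_sub_halsDualObj {N L : ℕ} (D : Matrix (Fin N) (Fin L) ℂ) (b : Fin N → ℂ)
    (τ : ℝ) {lam : ℝ} (hlam : 0 < lam) (h : Fin N → ℂ) (c : Fin L → ℂ) (z : Fin N → ℂ) :
    halsObj N L D b τ lam h c - halsDualObj N L D b lam z
      = (1 / 2) * e2norm (b - h - D.mulVec c + ((-1 : ℝ) : ℂ) • z) ^ 2
        + (τ * atomicNorm N h - (ip z h).re)
        + (1 / (2 * lam)) *
          e2norm (D.conjTranspose.mulVec z + ((-lam : ℝ) : ℂ) • c) ^ 2 := by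
  set w := b - h - D.mulVec c with hw
  have hb : b = w + h + D.mulVec c := by rw [hw]; abel
  have hbz : (ip b z).re = (ip w z).re + (ip z h).re + (ip (D.conjTranspose.mulVec z) c).re := by
    rw [hb, ip_re_add_left, ip_re_add_left, ip_mulVec_left, ip_re_comm h, ip_re_comm c]
  have hbsub : e2norm (b - z) ^ 2 = e2norm b ^ 2 + 2 * (-1) * (ip b z).re
      + (-1) ^ 2 * e2norm z ^ 2 := by
    rw [← e2norm_sq_add_smul]; simp [sub_eq_add_neg]
  rw [halsObj, halsDualObj, ← hw, hbsub, hbz, e2norm_sq_add_smul, e2norm_sq_add_smul]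
  field_simp
  ring

/-- Corollary 1 and strong duality: if `(ĥ, ĉ)` is primal optimal then
`ẑ = b − ĥ − Dĉ` is dual feasible, `g(ẑ) = f(ĥ, ĉ)`, and `ẑ` maximizes `g` over the
dual feasible set. -/
theorem stmt2 (N L : ℕ) (hN : 1 ≤ N) (hL : 1 ≤ L)
    (D : Matrix (Fin N) (Fin L) ℂ) (b : Fin N → ℂ)
    (τ lam : ℝ) (hτ : 0 < τ) (hlam : 0 < lam)
    (hhat : Fin N → ℂ) (chat : Fin L → ℂ)
    (hopt : ∀ (h : Fin N → ℂ) (c : Fin L → ℂ),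
      halsObj N L D b τ lam hhat chat ≤ halsObj N L D b τ lam h c) :
    dualAtomicNorm N (b - hhat - D.mulVec chat) ≤ τ ∧
    halsDualObj N L D b lam (b - hhat - D.mulVec chat) = halsObj N L D b τ lam hhat chat ∧
    ∀ z : Fin N → ℂ, dualAtomicNorm N z ≤ τ →
      halsDualObj N L D b lam z ≤ halsDualObj N L D b lam (b - hhat - D.mulVec chat) := by
  set z := b - hhat - D.mulVec chat with hz
  have hfeas : ∀ x, (ip z x).re ≤ τ * atomicNorm N x := fun x => by
    have := nonneg_of_forall_small (A := τ * atomicNorm N x - (ip z x).re)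
      (B := (1 / 2) * e2norm x ^ 2) fun t ht _ => by
        have h1 := hopt (hhat + (t : ℂ) • x) chat
        have h2 : b - (hhat + (t : ℂ) • x) - D.mulVec chat = z + ((-t : ℝ) : ℂ) • x := by
          rw [hz]; push_cast; module
        rw [halsObj, halsObj, h2, ← hz, e2norm_sq_add_smul] at h1
        have h3 := mul_le_mul_of_nonneg_left ((atomicNorm_add_le hN hhat ((t : ℂ) • x)).trans
          (add_le_add_right (atomicNorm_smul_le hN ht.le x) _)) hτ.le
        nlinarith
    linarith
  have htight : τ * atomicNorm N hhat ≤ (ip z hhat).re := by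
    have := nonneg_of_forall_small (A := (ip z hhat).re - τ * atomicNorm N hhat)
      (B := (1 / 2) * e2norm hhat ^ 2) fun t ht ht1 => by
        have h1 := hopt (((1 - t : ℝ) : ℂ) • hhat) chat
        have h2 : b - ((1 - t : ℝ) : ℂ) • hhat - D.mulVec chat = z + (t : ℂ) • hhat := by
          rw [hz]; push_cast; module
        rw [halsObj, halsObj, h2, ← hz, e2norm_sq_add_smul] at h1
        have h3 := mul_le_mul_of_nonneg_left
          (atomicNorm_smul_le hN (sub_nonneg.2 ht1) hhat) hτ.le
        nlinarith
    linarith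
  have hstat : D.conjTranspose.mulVec z + ((-lam : ℝ) : ℂ) • chat = 0 := by
    set d := D.conjTranspose.mulVec z + ((-lam : ℝ) : ℂ) • chat with hd
    apply eq_zero_of_ip_re_nonpos
    have := nonneg_of_forall_small (A := -(ip d d).re)
      (B := (1 / 2) * e2norm (D.mulVec d) ^ 2 + (lam / 2) * e2norm d ^ 2) fun t ht _ => by
        have h1 := hopt hhat (chat + (t : ℂ) • d)
        have h2 : b - hhat - D.mulVec (chat + (t : ℂ) • d)
            = z + ((-t : ℝ) : ℂ) • D.mulVec d := by
          rw [hz, Matrix.mulVec_add, Matrix.mulVec_smul]; push_cast; module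
        rw [halsObj, halsObj, h2, ← hz, e2norm_sq_add_smul, e2norm_sq_add_smul,
          ip_re_comm z, ip_mulVec_left, ip_re_comm d] at h1
        have h3 : (ip d d).re = (ip (D.conjTranspose.mulVec z) d).re
            + -lam * (ip chat d).re := by
          conv_lhs => rw [hd, ip_re_add_left, ip_re_smul_left, ← hd]
        rw [h3]
        linarith
    linarith
  have hdual : halsDualObj N L D b lam z = halsObj N L D b τ lam hhat chat := by
    have h := halsObj_sub_halsDualObj D b τ hlam hhat chat z
    have h0 : z + ((-1 : ℝ) : ℂ) • z = 0 := by push_cast; module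
    rw [hstat, ← hz, h0, htight.antisymm (hfeas hhat)] at h
    simp [e2norm] at h
    linarith
  refine ⟨dualAtomicNorm_le_of_ip_re_le hτ.le hfeas, hdual, fun y hy => ?_⟩
  rw [hdual, ← sub_nonneg, halsObj_sub_halsDualObj D b τ hlam]
  have := sub_nonneg.2 (ip_re_le_of_dualAtomicNorm_le hN hτ.le hy hhat)
  positivity
end
end

section
/- (Lemma 2, condition (iii).) Suppose (ĥ, ĉ) is a primal optimal solution of the HALS primal objective f. Then Re⟨b − ĥ − D ĉ, ĥ⟩ = τ ‖ĥ‖_A. -/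
open scoped BigOperators
open MeasureTheory

noncomputable section

theorem mul_mem_atomicDecomps {N : ℕ} {x : Fin N → ℂ} {s t : ℝ} (ht : 0 < t)
    (hs : s ∈ atomicDecomps N x) : t * s ∈ atomicDecomps N ((t : ℂ) • x) := by
  obtain ⟨p, c, a, hc, ha, rfl, rfl⟩ := hs
  refine ⟨p, fun i => t * c i, a, fun i => mul_pos ht (hc i), ha, ?_, Finset.mul_sum _ _ _⟩
  simp only [Finset.smul_sum, smul_smul, Complex.ofReal_mul]

open scoped Pointwise in
theorem atomicDecomps_smul {N : ℕ} (x : Fin N → ℂ) {t : ℝ} (ht : 0 < t) :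
    atomicDecomps N ((t : ℂ) • x) = t • atomicDecomps N x := by
  ext s
  rw [Set.mem_smul_set_iff_inv_smul_mem₀ ht.ne', smul_eq_mul]
  constructor
  · intro hs
    have h := mul_mem_atomicDecomps (inv_pos.mpr ht) hs
    rwa [smul_smul, ← Complex.ofReal_mul, inv_mul_cancel₀ ht.ne', Complex.ofReal_one,
      one_smul] at h
  · intro hs
    have h := mul_mem_atomicDecomps ht hs
    rwa [mul_inv_cancel_left₀ ht.ne'] at h

theorem atomicNorm_smul {N : ℕ} (x : Fin N → ℂ) {t : ℝ} (ht : 0 < t) :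
    atomicNorm N ((t : ℂ) • x) = t * atomicNorm N x := by
  rw [atomicNorm, atomicDecomps_smul x ht, Real.sInf_smul_of_nonneg ht.le, smul_eq_mul, atomicNorm]

theorem e2norm_sq_s5 {ι : Type*} [Fintype ι] (u : ι → ℂ) :
    e2norm u ^ 2 = ∑ k, Complex.normSq (u k) :=
  Real.sq_sqrt (Finset.sum_nonneg fun _ _ => Complex.normSq_nonneg _)

theorem e2norm_sub_smul_sq {N : ℕ} (u v : Fin N → ℂ) (s : ℝ) :
    e2norm (u - (s : ℂ) • v) ^ 2 =
      e2norm u ^ 2 - 2 * s * (ip u v).re + s ^ 2 * e2norm v ^ 2 := by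
  simp only [e2norm_sq_s5, ip, Complex.re_sum, Finset.mul_sum, ← Finset.sum_sub_distrib,
    ← Finset.sum_add_distrib]
  refine Finset.sum_congr rfl fun k _ => ?_
  simp [Complex.normSq_apply]
  ring

/-- A quadratic without constant term that is nonnegative near the origin has no linear term. -/
theorem eq_zero_of_forall_mul_add_sq_mul_nonneg {A B : ℝ} (hB : 0 ≤ B)
    (h : ∀ s : ℝ, -1 < s → 0 ≤ s * A + s ^ 2 * B) : A = 0 := by
  by_contra hA
  have hA' : 0 < |A| := abs_pos.mpr hA
  have hd : 0 < |A| + B + 1 := by positivity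
  have h1 : -1 < -A / (|A| + B + 1) := by
    rw [lt_div_iff₀ hd]
    linarith [le_abs_self A]
  have h2 := h _ h1
  have h3 : -A / (|A| + B + 1) * A + (-A / (|A| + B + 1)) ^ 2 * B =
      -(A ^ 2 * (|A| + 1)) / (|A| + B + 1) ^ 2 := by
    field_simp
    ring
  rw [h3] at h2
  have h4 : -(A ^ 2 * (|A| + 1)) / (|A| + B + 1) ^ 2 < 0 := by
    apply div_neg_of_neg_of_pos
    · have : 0 < A ^ 2 * (|A| + 1) := by positivity
      linarith
    · positivity
  linarith

/-- Lemma 2, condition (iii): `Re⟨b − ĥ − Dĉ, ĥ⟩ = τ‖ĥ‖_A` at a primal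
optimum. -/
theorem stmt5 (N L : ℕ) (hN : 1 ≤ N) (hL : 1 ≤ L)
    (D : Matrix (Fin N) (Fin L) ℂ) (b : Fin N → ℂ)
    (τ lam : ℝ) (hτ : 0 < τ) (hlam : 0 < lam)
    (hhat : Fin N → ℂ) (chat : Fin L → ℂ)
    (hopt : ∀ (h : Fin N → ℂ) (c : Fin L → ℂ),
      halsObj N L D b τ lam hhat chat ≤ halsObj N L D b τ lam h c) :
    (ip (b - hhat - D.mulVec chat) hhat).re = τ * atomicNorm N hhat := by
  refine (sub_eq_zero.mp
    (eq_zero_of_forall_mul_add_sq_mul_nonneg (B := e2norm hhat ^ 2 / 2) (by positivity)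
      fun s hs => ?_)).symm
  have h := hopt (((1 + s : ℝ) : ℂ) • hhat) chat
  have hr : b - ((1 + s : ℝ) : ℂ) • hhat - D.mulVec chat =
      (b - hhat - D.mulVec chat) - (s : ℂ) • hhat := by
    rw [Complex.ofReal_add, Complex.ofReal_one, add_smul, one_smul]
    abel
  rw [halsObj, halsObj, hr, e2norm_sub_smul_sq, atomicNorm_smul hhat (by linarith)] at h
  linarith
end
end

section
/- (Proposition 2: constrained Cramér-Rao bound under a subspace constraint, Gaussian location model.) Let n ≥ 1, let Σ ∈ ℝ^{n×n} be symmetric positive definite, let 1 ≤ p ≤ n, and let U ∈ ℝ^{n×p} satisfy Uᵀ U = I_p. Let θ₀ ∈ range(U). Let T : ℝ^n → ℝ^n be measurable with ∫‖T(y)‖₂² dμ_θ(y) < ∞ for all θ ∈ ℝ^n, and define the bias b(θ) = ∫ T(y) dμ_θ(y) − θ. Assume b is differentiable at θ₀ with derivative matrix B = ∇b(θ₀) ∈ ℝ^{n×n}, that b(θ₀) = 0, and that B U = 0 (local X-unbiasedness with respect to the subspace constraint θ ∈ range(U)). Then ∫ ‖T(y) − θ₀‖₂² dμ_{θ₀}(y)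 ≥ trace(U (Uᵀ Σ⁻¹ U)⁻¹ Uᵀ). -/
open scoped BigOperators
open MeasureTheory

noncomputable section

/-- The Euclidean (ℓ²) norm of a real vector. -/
def e2normR {ι : Type*} [Fintype ι] (u : ι → ℝ) : ℝ :=
  Real.sqrt (∑ k, (u k) ^ 2)

/-- The `n`-fold product of standard one-dimensional Gaussians. -/
def stdGaussianPi (n : ℕ) : Measure (Fin n → ℝ) :=
  Measure.pi fun _ => ProbabilityTheory.gaussianReal 0 1

/-- The Gaussian measure `μ_θ` on `ℝ^n` with mean `θ` and covariance `R·Rᵀ`: the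
pushforward of the product of standard Gaussians under `y ↦ θ + R y`.  With `R = Σ^{1/2}`
this is the Gaussian measure with mean `θ` and covariance `Σ`. -/
def gaussLoc (n : ℕ) (R : Matrix (Fin n) (Fin n) ℝ) (θ : Fin n → ℝ) :
    Measure (Fin n → ℝ) :=
  Measure.map (fun y => θ + R.mulVec y) (stdGaussianPi n)

open ProbabilityTheory in
theorem gaussianReal_eq_withDensity_gaussianReal_zero (m : ℝ) :
    gaussianReal m 1 =
      (gaussianReal 0 1).withDensity fun x => ENNReal.ofReal (Real.exp (m * x - m ^ 2 / 2)) := by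
  rw [gaussianReal_of_var_ne_zero m one_ne_zero, gaussianReal_of_var_ne_zero 0 one_ne_zero,
    ← withDensity_mul _ (measurable_gaussianPDF 0 1) (by fun_prop)]
  congr 1
  ext x
  rw [Pi.mul_apply, gaussianPDF, gaussianPDF, ← ENNReal.ofReal_mul (gaussianPDFReal_nonneg _ _ _),
    gaussianPDFReal, gaussianPDFReal, mul_assoc (_⁻¹), ← Real.exp_add]
  congr 3
  push_cast
  ring

/-- The density of the standard Gaussian measure translated by `a` with respect to the standard
Gaussian measure. -/
def shiftDensity {n : ℕ} (a z : Fin n → ℝ) : ℝ :=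
  ∏ i, Real.exp (a i * z i - a i ^ 2 / 2)

theorem shiftDensity_pos {n : ℕ} (a z : Fin n → ℝ) : 0 < shiftDensity a z :=
  Finset.prod_pos fun _ _ => Real.exp_pos _

theorem measurable_shiftDensity {n : ℕ} (a : Fin n → ℝ) : Measurable (shiftDensity a) := by
  unfold shiftDensity
  fun_prop

theorem shiftDensity_sq {n : ℕ} (a z : Fin n → ℝ) :
    shiftDensity a z ^ 2 = Real.exp (∑ i, a i ^ 2) * shiftDensity (2 • a) z := by
  simp only [shiftDensity, ← Real.exp_sum, ← Real.exp_nat_mul, ← Real.exp_add,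
    Finset.mul_sum, ← Finset.sum_add_distrib]
  congr 1
  refine Finset.sum_congr rfl fun i _ => ?_
  simp only [Pi.smul_apply, nsmul_eq_mul]
  push_cast
  ring

instance isProbabilityMeasure_stdGaussianPi (n : ℕ) : IsProbabilityMeasure (stdGaussianPi n) := by
  unfold stdGaussianPi
  infer_instance

/-- The **Cameron–Martin formula** for the standard Gaussian measure on `ℝⁿ`. -/
theorem stdGaussianPi_map_add {n : ℕ} (a : Fin n → ℝ) :
    (stdGaussianPi n).map (fun z => z + a) =
      (stdGaussianPi n).withDensity fun z => ENNReal.ofReal (shiftDensity a z) := by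
  have hmap : (stdGaussianPi n).map (fun z => z + a) =
      Measure.pi fun i => ProbabilityTheory.gaussianReal (a i) 1 := by
    unfold stdGaussianPi
    have := Measure.pi_map_pi (μ := fun _ : Fin n => ProbabilityTheory.gaussianReal 0 1)
      (f := fun i x => x + a i) (hμ := fun i => by
        rw [ProbabilityTheory.gaussianReal_map_add_const]; infer_instance)
      (fun i => by fun_prop)
    simp only [ProbabilityTheory.gaussianReal_map_add_const, zero_add] at this
    exact this
  rw [hmap]
  refine Measure.pi_eq fun s hs => ?_
  have hint : ∀ i, Integrable (fun x => Real.exp (a i * x - a i ^ 2 / 2))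
      ((ProbabilityTheory.gaussianReal 0 1).restrict (s i)) := fun i => by
    simp only [Real.exp_sub]
    exact ((ProbabilityTheory.integrable_exp_mul_gaussianReal (a i)).div_const _).restrict
  rw [withDensity_apply _ (MeasurableSet.univ_pi hs), stdGaussianPi, Measure.restrict_pi_pi]
  simp only [shiftDensity]
  rw [← ofReal_integral_eq_lintegral_ofReal (Integrable.fintype_prod_dep hint)
      (Filter.Eventually.of_forall fun z => (shiftDensity_pos a z).le),
    integral_fintype_prod_eq_prod (fun i x => Real.exp (a i * x - a i ^ 2 / 2)),
    ENNReal.ofReal_prod_of_nonneg fun i _ => integral_nonneg fun _ => (Real.exp_pos _).le]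
  refine Finset.prod_congr rfl fun i _ => ?_
  rw [gaussianReal_eq_withDensity_gaussianReal_zero (a i), withDensity_apply _ (hs i),
    ofReal_integral_eq_lintegral_ofReal (hint i)
      (Filter.Eventually.of_forall fun z => (Real.exp_pos _).le)]

theorem integral_comp_add_stdGaussianPi {n : ℕ} (a : Fin n → ℝ) {f : (Fin n → ℝ) → ℝ}
    (hf : Measurable f) :
    ∫ z, f (z + a) ∂stdGaussianPi n = ∫ z, shiftDensity a z * f z ∂stdGaussianPi n := by
  rw [← integral_map (f := f) (φ := fun z => z + a) (by fun_prop)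
    hf.aestronglyMeasurable, stdGaussianPi_map_add,
    integral_withDensity_eq_integral_toReal_smul (measurable_shiftDensity a).ennreal_ofReal
      (Filter.Eventually.of_forall fun _ => ENNReal.ofReal_lt_top)]
  simp only [ENNReal.toReal_ofReal (shiftDensity_pos a _).le, smul_eq_mul]

theorem integral_shiftDensity {n : ℕ} (a : Fin n → ℝ) :
    ∫ z, shiftDensity a z ∂stdGaussianPi n = 1 := by
  simpa using (integral_comp_add_stdGaussianPi a (f := fun _ => 1) measurable_const).symm

theorem integrable_shiftDensity {n : ℕ} (a : Fin n → ℝ) :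
    Integrable (shiftDensity a) (stdGaussianPi n) :=
  .of_integral_ne_zero (by simp [integral_shiftDensity])

theorem memLp_shiftDensity {n : ℕ} (a : Fin n → ℝ) :
    MemLp (shiftDensity a) 2 (stdGaussianPi n) := by
  rw [memLp_two_iff_integrable_sq (measurable_shiftDensity a).aestronglyMeasurable]
  simp only [shiftDensity_sq]
  exact (integrable_shiftDensity _).const_mul _

theorem integral_shiftDensity_sq {n : ℕ} (a : Fin n → ℝ) :
    ∫ z, shiftDensity a z ^ 2 ∂stdGaussianPi n = Real.exp (∑ i, a i ^ 2) := by
  simp only [shiftDensity_sq, integral_const_mul, integral_shiftDensity, mul_one]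

/-- A form of the **Hammersley–Chapman–Robbins inequality** for Gaussian shifts. -/
theorem hammersley_chapman_robbins_stdGaussianPi {n : ℕ} {f : (Fin n → ℝ) → ℝ} (hf : Measurable f)
    (hf2 : MemLp f 2 (stdGaussianPi n)) (a : Fin n → ℝ) (c : ℝ) :
    2 * c * (∫ z, f (z + a) ∂stdGaussianPi n - ∫ z, f z ∂stdGaussianPi n) -
      c ^ 2 * (Real.exp (∑ i, a i ^ 2) - 1) ≤ ∫ z, f z ^ 2 ∂stdGaussianPi n := by
  have h1 := integral_comp_add_stdGaussianPi a hf
  have hLf : Integrable (fun z => shiftDensity a z * f z) (stdGaussianPi n) :=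
    (memLp_shiftDensity a).integrable_mul hf2
  have hf1 : Integrable f (stdGaussianPi n) := hf2.integrable (by norm_num)
  have hL1 := integrable_shiftDensity a
  have hL2 := (memLp_shiftDensity a).integrable_sq
  have hff := hf2.integrable_sq
  have h0 : 0 ≤ ∫ z, (f z - c * (shiftDensity a z - 1)) ^ 2 ∂stdGaussianPi n :=
    integral_nonneg fun _ => sq_nonneg _
  have hexp : ∀ z, (f z - c * (shiftDensity a z - 1)) ^ 2 =
      f z ^ 2 - 2 * c * (shiftDensity a z * f z - f z) +
        c ^ 2 * (shiftDensity a z ^ 2 - 2 * shiftDensity a z + 1) := fun z => by ring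
  simp only [hexp] at h0
  have hcross : Integrable (fun z => 2 * c * (shiftDensity a z * f z - f z)) (stdGaussianPi n) :=
    (hLf.sub hf1).const_mul _
  have hL12 : Integrable (fun z => shiftDensity a z ^ 2 - 2 * shiftDensity a z)
      (stdGaussianPi n) := hL2.sub (hL1.const_mul 2)
  have hLsq : Integrable (fun z => c ^ 2 * (shiftDensity a z ^ 2 - 2 * shiftDensity a z + 1))
      (stdGaussianPi n) := (hL12.add (integrable_const 1)).const_mul _
  have hdiff : Integrable (fun z => f z ^ 2 - 2 * c * (shiftDensity a z * f z - f z))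
      (stdGaussianPi n) := hff.sub hcross
  rw [integral_add hdiff hLsq, integral_sub hff hcross, integral_const_mul, integral_const_mul,
    integral_sub hLf hf1, integral_add hL12 (integrable_const 1),
    integral_sub hL2 (hL1.const_mul 2), integral_const_mul, integral_shiftDensity,
    integral_shiftDensity_sq, ← h1] at h0
  simp only [integral_const, probReal_univ, one_smul] at h0
  linarith

/-- The **Cramér–Rao inequality** for Gaussian shifts along a line. -/
theorem cramer_rao_stdGaussianPi {n : ℕ} {f : (Fin n → ℝ) → ℝ} (hf : Measurable f)
    (hf2 : MemLp f 2 (stdGaussianPi n)) (a : Fin n → ℝ) {d : ℝ}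
    (hd : HasDerivAt (fun t : ℝ => ∫ z, f (z + t • a) ∂stdGaussianPi n) d 0) :
    2 * d - ∑ i, a i ^ 2 ≤ ∫ z, f z ^ 2 ∂stdGaussianPi n := by
  set q := ∑ i, a i ^ 2
  have hslope := hasDerivAt_iff_tendsto_slope_zero.1 hd
  have hu : Filter.Tendsto (fun t : ℝ => t⁻¹ ^ 2 * (Real.exp (t ^ 2 * q) - 1))
      (nhdsWithin 0 {0}ᶜ) (nhds q) := by
    have he : HasDerivAt (fun s : ℝ => Real.exp (s * q)) q 0 := by
      simpa using ((hasDerivAt_id (0 : ℝ)).mul_const q).exp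
    have hsq : Filter.Tendsto (fun t : ℝ => t ^ 2) (nhdsWithin 0 {0}ᶜ) (nhdsWithin 0 {0}ᶜ) := by
      refine tendsto_nhdsWithin_iff.2 ⟨?_, ?_⟩
      · have : Continuous fun t : ℝ => t ^ 2 := by fun_prop
        simpa using this.continuousAt.tendsto.mono_left (nhdsWithin_le_nhds (a := (0 : ℝ)))
      · filter_upwards [self_mem_nhdsWithin] with t ht
        exact pow_ne_zero 2 ht
    have := (hasDerivAt_iff_tendsto_slope_zero.1 he).comp hsq
    simpa [Function.comp_def] using this
  refine le_of_tendsto ((hslope.const_mul 2).sub hu) ?_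
  filter_upwards with t
  have h := hammersley_chapman_robbins_stdGaussianPi hf hf2 (t • a) t⁻¹
  have hq : ∑ i, (t • a) i ^ 2 = t ^ 2 * q := by
    simp [q, Finset.mul_sum, mul_pow]
  rw [hq] at h
  simpa [mul_assoc] using h

theorem e2normR_sq {ι : Type*} [Fintype ι] (u : ι → ℝ) : e2normR u ^ 2 = ∑ k, u k ^ 2 :=
  Real.sq_sqrt (Finset.sum_nonneg fun _ _ => sq_nonneg _)

theorem memLp_eval_of_integrable_e2normR_sq {α ι : Type*} [MeasurableSpace α] [Fintype ι]
    {μ : Measure α} {T : α → ι → ℝ} (hT : Measurable T)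
    (hint : Integrable (fun y => e2normR (T y) ^ 2) μ) (i : ι) :
    MemLp (fun y => T y i) 2 μ := by
  have hm : Measurable fun y => T y i := (measurable_pi_apply i).comp hT
  rw [memLp_two_iff_integrable_sq hm.aestronglyMeasurable]
  refine hint.mono' (hm.pow_const 2).aestronglyMeasurable (Filter.Eventually.of_forall fun y => ?_)
  rw [e2normR_sq, Real.norm_of_nonneg (sq_nonneg _)]
  exact Finset.single_le_sum (f := fun k => T y k ^ 2) (fun _ _ => sq_nonneg _)
    (Finset.mem_univ i)

theorem measurable_const_add_mulVec {n : ℕ} (R : Matrix (Fin n) (Fin n) ℝ) (θ : Fin n → ℝ) :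
    Measurable fun z => θ + R.mulVec z :=
  (continuous_const.add (continuous_const.matrix_mulVec continuous_id)).measurable

instance isProbabilityMeasure_gaussLoc (n : ℕ) (R : Matrix (Fin n) (Fin n) ℝ) (θ : Fin n → ℝ) :
    IsProbabilityMeasure (gaussLoc n R θ) :=
  Measure.isProbabilityMeasure_map (measurable_const_add_mulVec R θ).aemeasurable

/-- The **Cramér–Rao inequality** for the Gaussian location family, in the direction `R a`. -/
theorem cramer_rao_gaussLoc {n : ℕ} (R : Matrix (Fin n) (Fin n) ℝ) (θ : Fin n → ℝ)
    {g : (Fin n → ℝ) → ℝ} (hg : Measurable g) (hg2 : MemLp g 2 (gaussLoc n R θ))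
    (a : Fin n → ℝ) {d : ℝ}
    (hd : HasDerivAt (fun t : ℝ => ∫ y, g y ∂gaussLoc n R (θ + t • R.mulVec a)) d 0) :
    2 * d - ∑ i, a i ^ 2 ≤ ∫ y, g y ^ 2 ∂gaussLoc n R θ := by
  have hφ := measurable_const_add_mulVec R θ
  have hval : ∀ t : ℝ, ∫ y, g y ∂gaussLoc n R (θ + t • R.mulVec a) =
      ∫ z, g (θ + R.mulVec (z + t • a)) ∂stdGaussianPi n := fun t => by
    rw [gaussLoc, integral_map (measurable_const_add_mulVec R _).aemeasurable
      hg.aestronglyMeasurable]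
    refine integral_congr_ae (Filter.Eventually.of_forall fun z => ?_)
    simp only [Matrix.mulVec_add, Matrix.mulVec_smul]
    congr 1
    abel
  simp only [hval] at hd
  have h2 : MemLp (fun z => g (θ + R.mulVec z)) 2 (stdGaussianPi n) :=
    hg2.comp_of_map hφ.aemeasurable
  rw [gaussLoc, integral_map hφ.aemeasurable (hg.pow_const 2).aestronglyMeasurable]
  exact cramer_rao_stdGaussianPi (hg.comp hφ) h2 a hd

theorem sum_sq_inv_mulVec {n : ℕ} {R S : Matrix (Fin n) (Fin n) ℝ} (hR : R.transpose = R)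
    (hRR : R * R = S) (C : Matrix (Fin n) (Fin n) ℝ) (i : Fin n) :
    ∑ k, (R⁻¹.mulVec (C.col i)) k ^ 2 = (C.transpose * S⁻¹ * C) i i := by
  have h : C.transpose * S⁻¹ * C = (R⁻¹ * C).transpose * (R⁻¹ * C) := by
    rw [Matrix.transpose_mul, Matrix.transpose_nonsing_inv, hR, ← hRR, Matrix.mul_inv_rev]
    simp only [Matrix.mul_assoc]
  rw [h, Matrix.mul_apply]
  refine Finset.sum_congr rfl fun k _ => ?_
  rw [Matrix.transpose_apply, sq]
  rfl

/-- Proposition 2, constrained Cramér–Rao bound under a subspace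
constraint, Gaussian location model: if `θ₀ ∈ range(U)` with `UᵀU = I_p`, the bias
`b(θ) = ∫T dμ_θ − θ` is differentiable at `θ₀` with derivative matrix `B`, `b(θ₀) = 0`
and `BU = 0`, then `∫‖T(y) − θ₀‖₂² dμ_{θ₀}(y) ≥ trace(U(UᵀΣ⁻¹U)⁻¹Uᵀ)`. -/
theorem stmt16 (n p : ℕ) (hn : 1 ≤ n) (hp1 : 1 ≤ p) (hpn : p ≤ n)
    (S : Matrix (Fin n) (Fin n) ℝ) (hS : S.PosDef)
    (R : Matrix (Fin n) (Fin n) ℝ) (hR : R.PosSemidef) (hRR : R * R = S)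
    (U : Matrix (Fin n) (Fin p) ℝ) (hU : U.transpose * U = 1)
    (θ₀ : Fin n → ℝ) (hθ₀ : ∃ w : Fin p → ℝ, θ₀ = U.mulVec w)
    (T : (Fin n → ℝ) → (Fin n → ℝ)) (hTmeas : Measurable T)
    (hTint : ∀ θ : Fin n → ℝ, Integrable (fun y => e2normR (T y) ^ 2) (gaussLoc n R θ))
    (B : Matrix (Fin n) (Fin n) ℝ)
    (hbias : HasFDerivAt (fun θ : Fin n → ℝ => (∫ y, T y ∂(gaussLoc n R θ)) - θ)
      B.mulVecLin.toContinuousLinearMap θ₀)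
    (hb0 : (∫ y, T y ∂(gaussLoc n R θ₀)) - θ₀ = 0)
    (hBU : B * U = 0) :
    Matrix.trace (U * (U.transpose * S⁻¹ * U)⁻¹ * U.transpose) ≤
      ∫ y, e2normR (T y - θ₀) ^ 2 ∂(gaussLoc n R θ₀) := by
  have hdetS : IsUnit S.det := (Matrix.isUnit_iff_isUnit_det _).1 hS.isUnit
  have hdetR : IsUnit R.det := by
    rw [← hRR, Matrix.det_mul] at hdetS
    exact isUnit_of_mul_isUnit_left hdetS
  have hRt : R.transpose = R := by
    simpa using hR.isHermitian.eq
  have hUinj : Function.Injective U.mulVec := fun x y hxy => by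
    simpa [Matrix.mulVec_mulVec, hU] using congrArg U.transpose.mulVec hxy
  have hM : (U.transpose * S⁻¹ * U).PosDef := by
    simpa using hS.inv.conjTranspose_mul_mul_same hUinj
  set M := U.transpose * S⁻¹ * U with hMdef
  have hMt : M.transpose = M := by simpa using hM.isHermitian.eq
  have hdetM : IsUnit M.det := (Matrix.isUnit_iff_isUnit_det _).1 hM.isUnit
  set C := U * M⁻¹ * U.transpose with hC
  have hBC : B * C = 0 := by
    rw [hC, ← Matrix.mul_assoc, ← Matrix.mul_assoc, hBU, Matrix.zero_mul, Matrix.zero_mul]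
  have hCt : C.transpose = C := by
    rw [hC, Matrix.transpose_mul, Matrix.transpose_mul, Matrix.transpose_transpose,
      Matrix.transpose_nonsing_inv, hMt, Matrix.mul_assoc]
  have hCSC : C.transpose * S⁻¹ * C = C := by
    rw [hCt]
    calc C * S⁻¹ * C = U * (M⁻¹ * M) * M⁻¹ * U.transpose := by
          simp only [hC, hMdef, Matrix.mul_assoc]
      _ = C := by rw [Matrix.nonsing_inv_mul _ hdetM, Matrix.mul_one]
  have hL2 : ∀ θ i, MemLp (fun y => T y i) 2 (gaussLoc n R θ) := fun θ =>
    memLp_eval_of_integrable_e2normR_sq hTmeas (hTint θ)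
  have hL1 : ∀ θ i, Integrable (fun y => T y i) (gaussLoc n R θ) := fun θ i =>
    (hL2 θ i).integrable (by norm_num)
  have hdiff : ∀ i, MemLp (fun y => (T y - θ₀) i) 2 (gaussLoc n R θ₀) := fun i =>
    (hL2 θ₀ i).sub (memLp_const (θ₀ i))
  have hcoord : ∀ i, C i i ≤ ∫ y, (T y - θ₀) i ^ 2 ∂gaussLoc n R θ₀ := fun i => by
    set v := C.col i with hv
    have hline : HasDerivAt (fun t : ℝ => θ₀ + t • v) v 0 := by
      simpa using ((hasDerivAt_id (0 : ℝ)).smul_const v).const_add θ₀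
    have hline0 : θ₀ + (0 : ℝ) • v = θ₀ := by simp
    have hBv : B.mulVec v = 0 := by
      ext k
      exact congrFun (congrFun hBC k) i
    have hb : HasDerivAt (fun t : ℝ => (∫ y, T y ∂gaussLoc n R (θ₀ + t • v)) - (θ₀ + t • v))
        0 0 := by
      have := HasFDerivAt.comp_hasDerivAt (0 : ℝ) (hline0.symm ▸ hbias) hline
      simpa [Function.comp_def, hBv] using this
    have hmean := hasDerivAt_pi.1 (hb.add hline) i
    have hd : HasDerivAt (fun t : ℝ => ∫ y, (T y - θ₀) i ∂gaussLoc n R (θ₀ + t • v))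
        (C i i) 0 := by
      refine ((hmean.sub_const (θ₀ i)).congr_deriv ?_).congr_of_eventuallyEq
        (Filter.Eventually.of_forall fun t => ?_)
      · simp [hv, Matrix.col]
      · simp only [Pi.sub_apply]
        rw [integral_sub (hL1 _ i) (integrable_const _)]
        simp [eval_integral (hL1 _)]
    have hRv : R.mulVec (R⁻¹.mulVec v) = v := by
      rw [Matrix.mulVec_mulVec, Matrix.mul_nonsing_inv _ hdetR, Matrix.one_mulVec]
    have hcr := cramer_rao_gaussLoc R θ₀ (g := fun y => (T y - θ₀) i)
      ((measurable_pi_apply i).comp (hTmeas.sub_const θ₀)) (hdiff i) (R⁻¹.mulVec v)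
      (d := C i i) (by rw [hRv]; exact hd)
    rw [sum_sq_inv_mulVec hRt hRR, hCSC] at hcr
    linarith
  simp only [e2normR_sq]
  rw [integral_finsetSum _ fun i _ => (hdiff i).integrable_sq]
  exact Finset.sum_le_sum fun i _ => hcoord i
end
end
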